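/- For |q|<1, the two Rogers-Ramanujan identities hold: for r = 1 or 2, the sum over n ≥ 0 of q^(n² + (r-1)n)/(q;q)_n equals 1/((q^r; q^5)_∞ (q^(5-r); q^5)_∞). -/

import Mathlib

open scoped BigOperators

/-- The finite q-Pochhammer symbol `(a; q)_n = ∏_{j=0}^{n-1} (1 - a q^j)`. -/
noncomputable def qPoch (a q : ℂ) (n : ℕ) : ℂ := ∏ j ∈ Finset.range n, (1 - a * q ^ j)

/-- The infinite q-Pochhammer symbol `(a; q)_∞ = ∏_{j≥0} (1 - a q^j)`. -/
noncomputable def qPochInf (a q : ℂ) : ℂ := ∏' j : ℕ, (1 - a * q ^ j)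

open Finset Filter Topology

/-- The reciprocal `1 / (q; q)_n`. -/
noncomputable def qPochInv (q : ℂ) (n : ℕ) : ℂ := (qPoch q q n)⁻¹

theorem one_sub_mul_pow_ne_zero {a q : ℂ} (ha : ‖a‖ < 1) (hq : ‖q‖ < 1) (n : ℕ) :
    1 - a * q ^ n ≠ 0 := by
  refine sub_ne_zero.2 fun h => ?_
  have h1 : ‖a * q ^ n‖ < 1 := by
    rw [norm_mul, norm_pow]
    exact mul_lt_one_of_nonneg_of_lt_one_left (norm_nonneg _) ha
      (pow_le_one₀ (norm_nonneg _) hq.le)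
  rw [← h, norm_one] at h1
  exact lt_irrefl _ h1

theorem qPoch_ne_zero {a q : ℂ} (ha : ‖a‖ < 1) (hq : ‖q‖ < 1) (n : ℕ) : qPoch a q n ≠ 0 :=
  prod_ne_zero_iff.2 fun j _ => one_sub_mul_pow_ne_zero ha hq j

@[simp]
theorem qPochInv_zero (q : ℂ) : qPochInv q 0 = 1 := by simp [qPochInv, qPoch]

theorem one_sub_pow_succ_ne_zero {q : ℂ} (hq : ‖q‖ < 1) (n : ℕ) : 1 - q ^ (n + 1) ≠ 0 := by
  simpa [pow_succ'] using one_sub_mul_pow_ne_zero hq hq n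

theorem one_sub_pow_succ_mul_qPochInv {q : ℂ} (hq : ‖q‖ < 1) (n : ℕ) :
    (1 - q ^ (n + 1)) * qPochInv q (n + 1) = qPochInv q n := by
  have h1 := one_sub_pow_succ_ne_zero hq n
  have h2 := qPoch_ne_zero hq hq n
  have h3 : qPoch q q (n + 1) = qPoch q q n * (1 - q ^ (n + 1)) := by
    rw [qPoch, prod_range_succ, pow_succ', qPoch]
  rw [qPochInv, qPochInv, h3]
  field_simp

/-- A `q`-analogue of the Chu–Vandermonde identity. -/
theorem sum_qPochInv_vandermonde {q : ℂ} (hq : ‖q‖ < 1) (N M : ℕ) :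
    ∑ k ∈ range (N + 1), q ^ (k ^ 2 + M * k) *
        (qPochInv q (N - k) * (qPochInv q k * qPochInv q (k + M))) =
      qPochInv q N * qPochInv q (N + M) := by
  induction N generalizing M with
  | zero => simp
  | succ N ih =>
    apply mul_left_cancel₀ (one_sub_pow_succ_ne_zero hq N)
    have hsplit : (1 - q ^ (N + 1)) * ∑ k ∈ range (N + 2), q ^ (k ^ 2 + M * k) *
          (qPochInv q (N + 1 - k) * (qPochInv q k * qPochInv q (k + M))) =
        ∑ k ∈ range (N + 2), q ^ (k ^ 2 + M * k) * ((1 - q ^ (N + 1 - k)) *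
          qPochInv q (N + 1 - k) * (qPochInv q k * qPochInv q (k + M))) +
        ∑ k ∈ range (N + 2), q ^ (k ^ 2 + M * k + (N + 1 - k)) * (qPochInv q (N + 1 - k) *
          ((1 - q ^ k) * qPochInv q k * qPochInv q (k + M))) := by
      rw [mul_sum, ← sum_add_distrib]
      refine sum_congr rfl fun k hk => ?_
      have hk' : N + 1 = (N + 1 - k) + k := by have := mem_range.1 hk; omega
      have : q ^ (N + 1) = q ^ (N + 1 - k) * q ^ k := by rw [← pow_add, ← hk']
      rw [this, pow_add _ _ (N + 1 - k)]
      ring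
    rw [hsplit, sum_range_succ, sum_range_succ' _ (N + 1)]
    have h1 : ∑ k ∈ range (N + 1), q ^ (k ^ 2 + M * k) * ((1 - q ^ (N + 1 - k)) *
          qPochInv q (N + 1 - k) * (qPochInv q k * qPochInv q (k + M))) =
        qPochInv q N * qPochInv q (N + M) := by
      rw [← ih M]
      refine sum_congr rfl fun k hk => ?_
      have hk' : N + 1 - k = (N - k) + 1 := by have := mem_range.1 hk; omega
      rw [hk', one_sub_pow_succ_mul_qPochInv hq]
    have h2 : ∑ k ∈ range (N + 1), q ^ ((k + 1) ^ 2 + M * (k + 1) + (N + 1 - (k + 1))) *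
          (qPochInv q (N + 1 - (k + 1)) *
          ((1 - q ^ (k + 1)) * qPochInv q (k + 1) * qPochInv q (k + 1 + M))) =
        q ^ (N + M + 1) * (qPochInv q N * qPochInv q (N + (M + 1))) := by
      rw [← ih (M + 1), mul_sum]
      refine sum_congr rfl fun k hk => ?_
      obtain ⟨d, rfl⟩ := Nat.exists_eq_add_of_le (Nat.lt_succ_iff.1 (mem_range.1 hk))
      have e1 : k + d + 1 - (k + 1) = d := by omega
      have e2 : k + d - k = d := by omega
      rw [one_sub_pow_succ_mul_qPochInv hq, e1, e2, show k + 1 + M = k + (M + 1) by ring]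
      ring
    rw [h1, h2]
    have h3 := one_sub_pow_succ_mul_qPochInv hq N
    have h4 := one_sub_pow_succ_mul_qPochInv hq (N + M)
    rw [show N + 1 + M = N + M + 1 by ring, ← mul_assoc (1 - q ^ (N + 1)), h3, show N + (M + 1) = N + M + 1 by ring,
      ← h4]
    simp
    ring

/-- The Bailey transform with parameter `q ^ e`, iterating a Bailey pair once. -/
theorem sum_bailey_step {q : ℂ} (hq : ‖q‖ < 1) (e : ℕ) (α β : ℕ → ℂ)
    (h : ∀ n, ∑ m ∈ range (n + 1), α m * (qPochInv q (n - m) * qPochInv q (n + m + e)) = β n)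
    (n : ℕ) :
    ∑ m ∈ range (n + 1), q ^ (m ^ 2 + e * m) * α m *
        (qPochInv q (n - m) * qPochInv q (n + m + e)) =
      ∑ s ∈ range (n + 1), q ^ (s ^ 2 + e * s) * β s * qPochInv q (n - s) := by
  have h1 : ∀ s ∈ range (n + 1), q ^ (s ^ 2 + e * s) * β s * qPochInv q (n - s) =
      ∑ m ∈ range (s + 1), q ^ ((m + (s - m)) ^ 2 + e * (m + (s - m))) * α m *
        (qPochInv q (s - m) * qPochInv q (m + (s - m) + m + e)) *
        qPochInv q (n - (m + (s - m))) := by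
    intro s _
    rw [← h s, mul_sum, sum_mul]
    refine sum_congr rfl fun m hm => ?_
    rw [Nat.add_sub_cancel' (Nat.lt_succ_iff.1 (mem_range.1 hm))]
    ring
  rw [sum_congr rfl h1, sum_range_diag_flip (n + 1) fun m k =>
    q ^ ((m + k) ^ 2 + e * (m + k)) * α m *
      (qPochInv q k * qPochInv q (m + k + m + e)) * qPochInv q (n - (m + k))]
  refine sum_congr rfl fun m hm => ?_
  obtain ⟨d, rfl⟩ := Nat.exists_eq_add_of_le (Nat.lt_succ_iff.1 (mem_range.1 hm))
  have e1 : m + d + 1 - m = d + 1 := by omega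
  have e2 : m + d - m = d := by omega
  rw [e1, e2, show m + d + m + e = d + (2 * m + e) by ring,
    ← sum_qPochInv_vandermonde hq, mul_sum]
  refine sum_congr rfl fun k _ => ?_
  rw [show m + d - (m + k) = d - k by omega, show m + k + m + e = k + (2 * m + e) by ring]
  ring

/-- The numerators of the unit Bailey pair relative to `q ^ e`, for `e = 0` and `e = 1`. -/
noncomputable def unitBailey (q : ℂ) (e m : ℕ) : ℂ :=
  if e = 0 then (if m = 0 then 1 else (-1) ^ m * q ^ (m.choose 2) * (1 + q ^ m))
  else (-1) ^ m * q ^ (m.choose 2) * (1 - q ^ (2 * m + 1))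

theorem choose_two_succ (n : ℕ) : (n + 1).choose 2 = n + n.choose 2 := by
  rw [Nat.choose_succ_succ' n 1, Nat.choose_one_right]

theorem sum_unitBailey_zero {q : ℂ} (hq : ‖q‖ < 1) (n R : ℕ) (hR : R ≤ n) :
    (1 - q ^ n) * ∑ m ∈ range (R + 1), unitBailey q 0 m *
        (qPochInv q (n - m) * qPochInv q (n + m)) =
      (-1) ^ R * q ^ ((R + 1).choose 2) * (1 - q ^ (n - R)) *
        (qPochInv q (n - R) * qPochInv q (n + R)) := by
  induction R with
  | zero => simp [unitBailey]
  | succ R ih =>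
    rw [sum_range_succ, mul_add, ih (by omega)]
    obtain ⟨d, rfl⟩ := Nat.exists_eq_add_of_le hR
    have e1 : R + 1 + d - R = d + 1 := by omega
    have e2 : R + 1 + d - (R + 1) = d := by omega
    have h1 := one_sub_pow_succ_mul_qPochInv hq d
    have h2 := one_sub_pow_succ_mul_qPochInv hq (R + 1 + d + R)
    rw [e1, e2, ← add_assoc (R + 1 + d) R 1, ← h2, mul_assoc _ (1 - q ^ (d + 1)),
      ← mul_assoc (1 - q ^ (d + 1)), h1,
      choose_two_succ (R + 1), choose_two_succ R]
    simp only [unitBailey, if_true, Nat.succ_ne_zero, if_false, choose_two_succ]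
    ring

theorem sum_unitBailey_one {q : ℂ} (hq : ‖q‖ < 1) (n R : ℕ) (hR : R ≤ n) :
    (1 - q ^ n) * ∑ m ∈ range (R + 1), unitBailey q 1 m *
        (qPochInv q (n - m) * qPochInv q (n + m + 1)) =
      (-1) ^ R * q ^ ((R + 1).choose 2) * (1 - q ^ (R + 1)) * (1 - q ^ (n - R)) *
        (qPochInv q (n - R) * qPochInv q (n + R + 1)) := by
  induction R with
  | zero => simp [unitBailey]; ring
  | succ R ih =>
    rw [sum_range_succ, mul_add, ih (by omega)]
    obtain ⟨d, rfl⟩ := Nat.exists_eq_add_of_le hR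
    have e1 : R + 1 + d - R = d + 1 := by omega
    have e2 : R + 1 + d - (R + 1) = d := by omega
    have h1 := one_sub_pow_succ_mul_qPochInv hq d
    have h2 := one_sub_pow_succ_mul_qPochInv hq (R + 1 + d + R + 1)
    rw [e1, e2, ← add_assoc (R + 1 + d) R 1, ← h2, mul_assoc _ (1 - q ^ (d + 1)),
      ← mul_assoc (1 - q ^ (d + 1)), h1,
      choose_two_succ (R + 1), choose_two_succ R]
    simp only [unitBailey, one_ne_zero, if_false, choose_two_succ]
    ring

theorem sum_unitBailey {q : ℂ} (hq : ‖q‖ < 1) {e : ℕ} (he : e = 0 ∨ e = 1) (n : ℕ) :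
    ∑ m ∈ range (n + 1), unitBailey q e m * (qPochInv q (n - m) * qPochInv q (n + m + e)) =
      if n = 0 then 1 else 0 := by
  rcases n with _ | n
  · have := one_sub_pow_succ_mul_qPochInv hq 0
    rcases he with rfl | rfl <;> simp_all [unitBailey]
  · apply mul_left_cancel₀ (one_sub_pow_succ_ne_zero hq n)
    rcases he with rfl | rfl
    · simpa using sum_unitBailey_zero hq (n + 1) (n + 1) le_rfl
    · simpa using sum_unitBailey_one hq (n + 1) (n + 1) le_rfl

/-- A finite form of the Rogers–Ramanujan identities. -/
theorem sum_rogersRamanujan_finite {q : ℂ} (hq : ‖q‖ < 1) {e : ℕ} (he : e = 0 ∨ e = 1) (n : ℕ) :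
    ∑ m ∈ range (n + 1), q ^ (m ^ 2 + e * m) * (q ^ (m ^ 2 + e * m) * unitBailey q e m) *
        (qPochInv q (n - m) * qPochInv q (n + m + e)) =
      ∑ s ∈ range (n + 1), q ^ (s ^ 2 + e * s) * qPochInv q s * qPochInv q (n - s) := by
  refine sum_bailey_step hq e _ _ (fun k => ?_) n
  rw [sum_bailey_step hq e _ _ (sum_unitBailey hq he), sum_eq_single 0] <;> simp +contextual

/-- The finite `q`-binomial theorem in homogeneous form. -/
theorem sum_qBinomial {p : ℂ} (hp : ‖p‖ < 1) (a b : ℂ) (L : ℕ) :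
    ∑ j ∈ range (L + 1), (-1) ^ j * p ^ (j.choose 2) * b ^ j * a ^ (L - j) *
        (qPochInv p j * qPochInv p (L - j)) =
      qPochInv p L * ∏ i ∈ range L, (a - b * p ^ i) := by
  induction L generalizing b with
  | zero => simp
  | succ L ih =>
    apply mul_left_cancel₀ (one_sub_pow_succ_ne_zero hp L)
    have hsplit : (1 - p ^ (L + 1)) * ∑ j ∈ range (L + 2), (-1) ^ j * p ^ (j.choose 2) * b ^ j *
          a ^ (L + 1 - j) * (qPochInv p j * qPochInv p (L + 1 - j)) =
        ∑ j ∈ range (L + 2), (-1) ^ j * p ^ (j.choose 2) * b ^ j * a ^ (L + 1 - j) *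
          ((1 - p ^ j) * qPochInv p j * qPochInv p (L + 1 - j)) +
        ∑ j ∈ range (L + 2), (-1) ^ j * p ^ (j.choose 2) * (b * p) ^ j * a ^ (L + 1 - j) *
          (qPochInv p j * ((1 - p ^ (L + 1 - j)) * qPochInv p (L + 1 - j))) := by
      rw [mul_sum, ← sum_add_distrib]
      refine sum_congr rfl fun j hj => ?_
      have hj' : L + 1 = (L + 1 - j) + j := by have := mem_range.1 hj; omega
      have : p ^ (L + 1) = p ^ (L + 1 - j) * p ^ j := by rw [← pow_add, ← hj']
      rw [this]
      ring
    have h1 : ∑ j ∈ range (L + 1), (-1) ^ (j + 1) * p ^ ((j + 1).choose 2) * b ^ (j + 1) *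
          a ^ (L + 1 - (j + 1)) *
          ((1 - p ^ (j + 1)) * qPochInv p (j + 1) * qPochInv p (L + 1 - (j + 1))) =
        -b * (qPochInv p L * ∏ i ∈ range L, (a - b * p * p ^ i)) := by
      rw [← ih (b * p), mul_sum]
      refine sum_congr rfl fun j _ => ?_
      rw [one_sub_pow_succ_mul_qPochInv hp, choose_two_succ, Nat.add_sub_add_right]
      ring
    have h2 : ∑ j ∈ range (L + 1), (-1) ^ j * p ^ (j.choose 2) * (b * p) ^ j * a ^ (L + 1 - j) *
          (qPochInv p j * ((1 - p ^ (L + 1 - j)) * qPochInv p (L + 1 - j))) =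
        a * (qPochInv p L * ∏ i ∈ range L, (a - b * p * p ^ i)) := by
      rw [← ih (b * p), mul_sum]
      refine sum_congr rfl fun j hj => ?_
      have hj' : L + 1 - j = (L - j) + 1 := by have := mem_range.1 hj; omega
      rw [hj', one_sub_pow_succ_mul_qPochInv hp]
      ring
    rw [hsplit, sum_range_succ' _ (L + 1), h1, sum_range_succ _ (L + 1), h2, ← mul_assoc (1 - p ^ (L + 1)),
      one_sub_pow_succ_mul_qPochInv hp, prod_range_succ']
    simp only [pow_succ', ← mul_assoc]
    simp
    ring

theorem summable_norm_mul_pow (a : ℂ) {q : ℂ} (hq : ‖q‖ < 1) :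
    Summable fun j : ℕ => ‖-(a * q ^ j)‖ := by
  simp only [norm_neg, norm_mul, norm_pow]
  exact (summable_geometric_of_lt_one (norm_nonneg _) hq).mul_left _

theorem tendsto_qPoch (a : ℂ) {q : ℂ} (hq : ‖q‖ < 1) :
    Tendsto (qPoch a q) atTop (𝓝 (qPochInf a q)) := by
  have h := (multipliable_one_add_of_summable
    (summable_norm_mul_pow a hq)).hasProd.tendsto_prod_nat
  simp only [← sub_eq_add_neg] at h
  exact h

theorem qPochInf_ne_zero {a q : ℂ} (ha : ‖a‖ < 1) (hq : ‖q‖ < 1) : qPochInf a q ≠ 0 := by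
  have h := tprod_one_add_ne_zero_of_summable (f := fun j : ℕ => -(a * q ^ j))
    (fun j => by simpa [← sub_eq_add_neg] using one_sub_mul_pow_ne_zero ha hq j)
    (summable_norm_mul_pow a hq)
  simp only [← sub_eq_add_neg] at h
  exact h

theorem tendsto_qPochInv {q : ℂ} (hq : ‖q‖ < 1) :
    Tendsto (qPochInv q) atTop (𝓝 (qPochInf q q)⁻¹) :=
  (tendsto_qPoch q hq).inv₀ (qPochInf_ne_zero hq hq)

theorem exists_norm_qPochInv_le {q : ℂ} (hq : ‖q‖ < 1) :
    ∃ C : ℝ, 0 ≤ C ∧ ∀ n, ‖qPochInv q n‖ ≤ C := by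
  obtain ⟨C, hC⟩ :=
    (Metric.isBounded_range_of_tendsto _ (tendsto_qPochInv hq)).exists_norm_le
  have hC' : ∀ n, ‖qPochInv q n‖ ≤ C := fun n => hC _ ⟨n, rfl⟩
  exact ⟨C, (norm_nonneg _).trans (hC' 0), hC'⟩

/-- Tannery's theorem for weighted partial sums. -/
theorem tendsto_sum_range_mul {A : ℕ → ℂ} (hA : Summable fun m => ‖A m‖) {w : ℕ → ℕ → ℂ} {W : ℂ}
    {C : ℝ} (hC : ∀ N m, ‖w N m‖ ≤ C) (hw : ∀ m, Tendsto (fun N => w N m) atTop (𝓝 W)) :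
    Tendsto (fun N => ∑ m ∈ range (N + 1), A m * w N m) atTop (𝓝 ((∑' m, A m) * W)) := by
  have h := tendsto_tsum_of_dominated_convergence (𝓕 := atTop)
    (f := fun N m => if m ∈ range (N + 1) then A m * w N m else 0)
    (g := fun m => A m * W) (bound := fun m => ‖A m‖ * C) (hA.mul_right C) (fun m => ?_)
    (Eventually.of_forall fun N m => ?_)
  · rw [tsum_mul_right] at h
    refine h.congr fun N => ?_
    rw [tsum_eq_sum (s := range (N + 1)) fun m hm => if_neg hm]
    exact sum_congr rfl fun m hm => if_pos hm
  · refine ((hw m).const_mul (A m)).congr' ?_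
    filter_upwards [eventually_ge_atTop m] with N hN
    rw [if_pos (mem_range.2 (Nat.lt_succ_of_le hN))]
  · split_ifs
    · rw [norm_mul]
      exact mul_le_mul_of_nonneg_left (hC N m) (norm_nonneg _)
    · rw [norm_zero]
      exact mul_nonneg (norm_nonneg _) ((norm_nonneg _).trans (hC N m))

theorem tendsto_sum_range_mul_qPochInv {q : ℂ} (hq : ‖q‖ < 1) {A : ℕ → ℂ}
    (hA : Summable fun m => ‖A m‖) :
    Tendsto (fun N => ∑ m ∈ range (N + 1), A m * qPochInv q (N - m)) atTop
      (𝓝 ((∑' m, A m) * (qPochInf q q)⁻¹)) := by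
  obtain ⟨C, -, hC⟩ := exists_norm_qPochInv_le hq
  exact tendsto_sum_range_mul hA (fun N m => hC (N - m))
    fun m => (tendsto_qPochInv hq).comp (tendsto_sub_atTop_nat m)

theorem tendsto_sum_range_mul_qPochInv_mul {q : ℂ} (hq : ‖q‖ < 1) (e : ℕ) {A : ℕ → ℂ}
    (hA : Summable fun m => ‖A m‖) :
    Tendsto (fun N => ∑ m ∈ range (N + 1), A m * (qPochInv q (N - m) * qPochInv q (N + m + e)))
      atTop (𝓝 ((∑' m, A m) * ((qPochInf q q)⁻¹ * (qPochInf q q)⁻¹))) := by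
  obtain ⟨C, hC0, hC⟩ := exists_norm_qPochInv_le hq
  refine tendsto_sum_range_mul hA (w := fun N m => qPochInv q (N - m) * qPochInv q (N + m + e))
    (C := C * C) (fun N m => ?_) fun m => ?_
  · rw [norm_mul]
    exact mul_le_mul (hC _) (hC _) (norm_nonneg _) hC0
  · refine ((tendsto_qPochInv hq).comp (tendsto_sub_atTop_nat m)).mul
      (((tendsto_qPochInv hq).comp (tendsto_add_atTop_nat (m + e))).congr fun N => ?_)
    rw [Function.comp_apply, add_assoc]

theorem norm_pow_sq_add_le {q : ℂ} (hq : ‖q‖ < 1) (e m : ℕ) :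
    ‖q ^ (m ^ 2 + e * m)‖ ≤ ‖q‖ ^ m := by
  rw [norm_pow]
  exact pow_le_pow_of_le_one (norm_nonneg _) hq.le
    ((Nat.le_self_pow two_ne_zero m).trans (Nat.le_add_right _ _))

theorem norm_unitBailey_le {q : ℂ} (hq : ‖q‖ < 1) (e m : ℕ) : ‖unitBailey q e m‖ ≤ 2 := by
  have hpow : ∀ k, ‖q ^ k‖ ≤ 1 := fun k => by
    rw [norm_pow]
    exact pow_le_one₀ (norm_nonneg _) hq.le
  have hmul : ∀ z : ℂ, ‖z‖ ≤ 2 → ‖(-1) ^ m * q ^ (m.choose 2) * z‖ ≤ 2 := fun z hz => by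
    rw [norm_mul, norm_mul, norm_pow, norm_neg, norm_one, one_pow, one_mul]
    exact (mul_le_of_le_one_left (norm_nonneg _) (hpow _)).trans hz
  unfold unitBailey
  split_ifs
  · norm_num
  · refine hmul _ ((norm_add_le _ _).trans ?_)
    rw [norm_one]
    linarith [hpow m]
  · refine hmul _ ((norm_sub_le _ _).trans ?_)
    rw [norm_one]
    linarith [hpow (2 * m + 1)]

/-- The coefficients of the theta series obtained by iterating the unit Bailey pair twice. -/
noncomputable def thetaCoeff (q : ℂ) (e m : ℕ) : ℂ :=
  q ^ (m ^ 2 + e * m) * (q ^ (m ^ 2 + e * m) * unitBailey q e m)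

theorem summable_norm_thetaCoeff {q : ℂ} (hq : ‖q‖ < 1) (e : ℕ) :
    Summable fun m => ‖thetaCoeff q e m‖ := by
  refine Summable.of_nonneg_of_le (fun _ => norm_nonneg _) (fun m => ?_)
    ((summable_geometric_of_lt_one (norm_nonneg q) hq).mul_right (1 * 2))
  rw [thetaCoeff, norm_mul, norm_mul]
  have h1 : ‖q ^ (m ^ 2 + e * m)‖ ≤ 1 := by
    rw [norm_pow]
    exact pow_le_one₀ (norm_nonneg _) hq.le
  have := norm_pow_sq_add_le hq e m
  have := norm_unitBailey_le hq e m
  gcongr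

theorem summable_norm_pow_mul_qPochInv {q : ℂ} (hq : ‖q‖ < 1) (e : ℕ) :
    Summable fun s => ‖q ^ (s ^ 2 + e * s) * qPochInv q s‖ := by
  obtain ⟨C, -, hC⟩ := exists_norm_qPochInv_le hq
  refine Summable.of_nonneg_of_le (fun _ => norm_nonneg _) (fun s => ?_)
    ((summable_geometric_of_lt_one (norm_nonneg q) hq).mul_right C)
  rw [norm_mul]
  have := norm_pow_sq_add_le hq e s
  have := hC s
  gcongr

theorem tsum_pow_mul_qPochInv {q : ℂ} (hq : ‖q‖ < 1) {e : ℕ} (he : e = 0 ∨ e = 1) :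
    ∑' s, q ^ (s ^ 2 + e * s) * qPochInv q s = (∑' m, thetaCoeff q e m) * (qPochInf q q)⁻¹ := by
  have h1 := tendsto_sum_range_mul_qPochInv hq (summable_norm_pow_mul_qPochInv hq e)
  have h2 := tendsto_sum_range_mul_qPochInv_mul hq e (summable_norm_thetaCoeff hq e)
  have h3 := tendsto_nhds_unique h1 (h2.congr fun n => sum_rogersRamanujan_finite hq he n)
  rw [← mul_assoc] at h3
  exact mul_right_cancel₀ (inv_ne_zero (qPochInf_ne_zero hq hq)) h3

theorem prod_pow_sub_pow (q : ℂ) {c : ℕ} (hc : c ≤ 5) (N K : ℕ) :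
    ∏ i ∈ range (N + K), (q ^ (5 * N) - q ^ c * (q ^ 5) ^ i) =
      (-1) ^ N * q ^ (5 * N.choose 2 + c * N + 5 * N * K) *
        (qPoch (q ^ (5 - c)) (q ^ 5) N * qPoch (q ^ c) (q ^ 5) K) := by
  have hconst : ∏ i ∈ range N, (-(q ^ c * (q ^ 5) ^ i)) =
      (-1) ^ N * q ^ (5 * N.choose 2 + c * N) := by
    induction N with
    | zero => simp
    | succ N ih =>
      rw [prod_range_succ, ih, choose_two_succ]
      ring
  have h1 : ∏ i ∈ range N, (q ^ (5 * N) - q ^ c * (q ^ 5) ^ i) =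
      (-1) ^ N * q ^ (5 * N.choose 2 + c * N) * qPoch (q ^ (5 - c)) (q ^ 5) N := by
    rw [← hconst, qPoch,
      ← prod_range_reflect (fun j => 1 - q ^ (5 - c) * (q ^ 5) ^ j), ← prod_mul_distrib]
    refine prod_congr rfl fun i hi => ?_
    obtain ⟨d, rfl⟩ := Nat.exists_eq_add_of_lt (mem_range.1 hi)
    obtain ⟨b, hb⟩ := Nat.exists_eq_add_of_le hc
    have e1 : i + d + 1 - 1 - i = d := by omega
    have e2 : 5 - c = b := by omega
    have e3 : q ^ (5 * (i + d + 1)) = q ^ c * (q ^ 5) ^ i * (q ^ b * (q ^ 5) ^ d) := by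
      simp only [← pow_mul, ← pow_add]
      congr 1
      omega
    rw [e1, e2, e3]
    ring
  have h2 : ∏ i ∈ range K, (q ^ (5 * N) - q ^ c * (q ^ 5) ^ (N + i)) =
      q ^ (5 * N * K) * qPoch (q ^ c) (q ^ 5) K := by
    have hK : q ^ (5 * N * K) = ∏ _i ∈ range K, q ^ (5 * N) := by simp [pow_mul]
    rw [qPoch, hK, ← prod_mul_distrib]
    refine prod_congr rfl fun i _ => ?_
    ring
  rw [prod_range_add, h1, h2]
  ring

/-- A finite form of the Jacobi triple product in base `q ^ 5`. -/
theorem sum_tripleProduct_finite {q : ℂ} (hq : ‖q‖ < 1) {c : ℕ} (hc : c ≤ 5) (N K : ℕ) :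
    ∑ j ∈ range (N + K + 1), (-1) ^ j * q ^ (5 * j.choose 2 + c * j + 5 * N * (N + K - j)) *
        (qPochInv (q ^ 5) j * qPochInv (q ^ 5) (N + K - j)) =
      (-1) ^ N * q ^ (5 * N.choose 2 + c * N + 5 * N * K) * (qPochInv (q ^ 5) (N + K) *
        (qPoch (q ^ (5 - c)) (q ^ 5) N * qPoch (q ^ c) (q ^ 5) K)) := by
  have hp : ‖q ^ 5‖ < 1 := by
    rw [norm_pow]
    exact pow_lt_one₀ (norm_nonneg _) hq (by norm_num)
  rw [mul_left_comm, ← prod_pow_sub_pow q hc, ← sum_qBinomial hp]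
  refine sum_congr rfl fun j _ => ?_
  rw [pow_add, pow_add]
  simp only [pow_mul]
  ring

theorem sum_range_fold (f : ℕ → ℂ) (N K : ℕ) :
    ∑ j ∈ range (N + K), f j = ∑ m ∈ range N, f (N - 1 - m) + ∑ m ∈ range K, f (N + m) := by
  rw [sum_range_reflect, sum_range_add]

theorem two_mul_choose_two_add (n : ℕ) : 2 * n.choose 2 + n = n * n := by
  induction n with
  | zero => simp
  | succ n ih => rw [choose_two_succ]; linarith

theorem sum_thetaCoeff_zero_finite {q : ℂ} (hq : ‖q‖ < 1) (hq0 : q ≠ 0) (N : ℕ) :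
    ∑ m ∈ range (N + 1), thetaCoeff q 0 m *
        (qPochInv (q ^ 5) (N - m) * qPochInv (q ^ 5) (N + m + 0)) =
      qPochInv (q ^ 5) (N + N) * (qPoch (q ^ 3) (q ^ 5) N * qPoch (q ^ 2) (q ^ 5) N) := by
  apply mul_left_cancel₀ (mul_ne_zero (pow_ne_zero N (neg_ne_zero.2 one_ne_zero))
    (pow_ne_zero (5 * N.choose 2 + 2 * N + 5 * N * N) hq0))
  rw [← sum_tripleProduct_finite hq (by norm_num : 2 ≤ 5), add_assoc N N 1, sum_range_fold _ N (N + 1),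
    sum_range_succ' _ N, sum_range_succ' _ N, mul_add, ← add_assoc, ← sum_add_distrib, mul_sum]
  congr 1
  · refine sum_congr rfl fun m hm => ?_
    obtain ⟨d, rfl⟩ := Nat.exists_eq_add_of_lt (mem_range.1 hm)
    have e1 : m + d + 1 - 1 - m = d := by omega
    have e2 : m + d + 1 - (m + 1) = d := by omega
    have e3 : m + d + 1 + (m + d + 1) - d = m + d + 1 + (m + 1) := by omega
    have e4 : m + d + 1 + (m + d + 1) - (m + d + 1 + (m + 1)) = d := by omega
    rw [e1, e2, e3, e4]
    have c1 := two_mul_choose_two_add d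
    have c2 := two_mul_choose_two_add (m + 1)
    have c3 := two_mul_choose_two_add (m + d + 1)
    have c4 := two_mul_choose_two_add (m + d + 1 + (m + 1))
    have x1 : 5 * d.choose 2 + 2 * d + 5 * (m + d + 1) * (m + d + 1 + (m + 1)) =
        (5 * (m + d + 1).choose 2 + 2 * (m + d + 1) + 5 * (m + d + 1) * (m + d + 1)) +
          ((m + 1) ^ 2 + (m + 1) ^ 2 + (m + 1).choose 2 + (m + 1)) := by nlinarith
    have x2 : 5 * (m + d + 1 + (m + 1)).choose 2 + 2 * (m + d + 1 + (m + 1)) +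
          5 * (m + d + 1) * d =
        (5 * (m + d + 1).choose 2 + 2 * (m + d + 1) + 5 * (m + d + 1) * (m + d + 1)) +
          ((m + 1) ^ 2 + (m + 1) ^ 2 + (m + 1).choose 2) := by nlinarith
    have s1 : (-1 : ℂ) ^ d = (-1) ^ (m + d + 1) * (-1) ^ (m + 1) := by
      rw [← pow_add, show m + d + 1 + (m + 1) = d + 2 * (m + 1) by ring, pow_add, pow_mul]
      simp
    rw [x1, x2, s1, pow_add (-1 : ℂ) (m + d + 1) (m + 1)]
    simp only [thetaCoeff, unitBailey, if_true, Nat.succ_ne_zero, if_false, pow_add q, add_zero,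
      zero_mul]
    ring
  · simp [thetaCoeff, unitBailey]

theorem sum_thetaCoeff_one_finite {q : ℂ} (hq : ‖q‖ < 1) (hq0 : q ≠ 0) (N : ℕ) :
    ∑ m ∈ range (N + 1), thetaCoeff q 1 m *
        (qPochInv (q ^ 5) (N - m) * qPochInv (q ^ 5) (N + m + 1)) =
      qPochInv (q ^ 5) (N + (N + 1)) *
        (qPoch (q ^ 4) (q ^ 5) N * qPoch (q ^ 1) (q ^ 5) (N + 1)) := by
  apply mul_left_cancel₀ (mul_ne_zero (pow_ne_zero N (neg_ne_zero.2 one_ne_zero))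
    (pow_ne_zero (5 * N.choose 2 + 1 * N + 5 * N * (N + 1)) hq0))
  rw [← sum_tripleProduct_finite hq (by norm_num : 1 ≤ 5),
    show N + (N + 1) + 1 = (N + 1) + (N + 1) by ring,
    sum_range_fold _ (N + 1) (N + 1), ← sum_add_distrib, mul_sum]
  refine sum_congr rfl fun m hm => ?_
  obtain ⟨d, rfl⟩ := Nat.exists_eq_add_of_le (Nat.lt_succ_iff.1 (mem_range.1 hm))
  have e1 : m + d + 1 - 1 - m = d := by omega
  have e2 : m + d - m = d := by omega
  have e3 : m + d + (m + d + 1) - d = m + d + 1 + m := by omega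
  have e4 : m + d + (m + d + 1) - (m + d + 1 + m) = d := by omega
  rw [e1, e2, e3, e4, show m + d + m + 1 = m + d + 1 + m by ring]
  have c1 := two_mul_choose_two_add d
  have c2 := two_mul_choose_two_add m
  have c3 := two_mul_choose_two_add (m + d)
  have c4 := two_mul_choose_two_add (m + d + 1 + m)
  have x1 : 5 * d.choose 2 + 1 * d + 5 * (m + d) * (m + d + 1 + m) =
      (5 * (m + d).choose 2 + 1 * (m + d) + 5 * (m + d) * (m + d + 1)) +
        ((m ^ 2 + 1 * m) + (m ^ 2 + 1 * m) + m.choose 2) := by nlinarith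
  have x2 : 5 * (m + d + 1 + m).choose 2 + 1 * (m + d + 1 + m) + 5 * (m + d) * d =
      (5 * (m + d).choose 2 + 1 * (m + d) + 5 * (m + d) * (m + d + 1)) +
        ((m ^ 2 + 1 * m) + (m ^ 2 + 1 * m) + m.choose 2 + (2 * m + 1)) := by nlinarith
  have s1 : (-1 : ℂ) ^ d = (-1) ^ (m + d) * (-1) ^ m := by
    rw [← pow_add, show m + d + m = d + 2 * m by ring, pow_add, pow_mul]
    simp
  have s2 : (-1 : ℂ) ^ (m + d + 1 + m) = -((-1) ^ (m + d) * (-1) ^ m) := by ring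
  rw [x1, x2, s1, s2]
  simp only [thetaCoeff, unitBailey, one_ne_zero, if_false, pow_add q]
  ring

theorem norm_pow_lt_one {q : ℂ} (hq : ‖q‖ < 1) {k : ℕ} (hk : k ≠ 0) : ‖q ^ k‖ < 1 := by
  rw [norm_pow]
  exact pow_lt_one₀ (norm_nonneg _) hq hk

theorem tsum_thetaCoeff_of_finite {q : ℂ} (hq : ‖q‖ < 1) (e a b : ℕ)
    (h : ∀ N, ∑ m ∈ range (N + 1), thetaCoeff q e m *
        (qPochInv (q ^ 5) (N - m) * qPochInv (q ^ 5) (N + m + e)) =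
      qPochInv (q ^ 5) (N + (N + e)) * (qPoch (q ^ a) (q ^ 5) N * qPoch (q ^ b) (q ^ 5) (N + e))) :
    ∑' m, thetaCoeff q e m =
      qPochInf (q ^ 5) (q ^ 5) * (qPochInf (q ^ a) (q ^ 5) * qPochInf (q ^ b) (q ^ 5)) := by
  have hp := norm_pow_lt_one hq (k := 5) (by norm_num)
  have h1 := tendsto_sum_range_mul_qPochInv_mul hp e (summable_norm_thetaCoeff hq e)
  have he := tendsto_add_atTop_nat e
  have h2 := ((tendsto_qPochInv hp).comp (tendsto_id.atTop_add_atTop he)).mul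
    ((tendsto_qPoch (q ^ a) hp).mul ((tendsto_qPoch (q ^ b) hp).comp he))
  have h3 := tendsto_nhds_unique h1 (h2.congr fun N => (h N).symm)
  have hP := qPochInf_ne_zero hp hp
  field_simp at h3
  rw [h3]
  ring

theorem qPoch_five_mul (q : ℂ) (N : ℕ) :
    qPoch q q (5 * N) = qPoch (q ^ 1) (q ^ 5) N * qPoch (q ^ 2) (q ^ 5) N *
      qPoch (q ^ 3) (q ^ 5) N * qPoch (q ^ 4) (q ^ 5) N * qPoch (q ^ 5) (q ^ 5) N := by
  induction N with
  | zero => simp [qPoch]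
  | succ N ih =>
    simp only [qPoch] at ih ⊢
    rw [show 5 * (N + 1) = 5 * N + 1 + 1 + 1 + 1 + 1 by ring]
    simp only [prod_range_succ, ih]
    ring

theorem qPochInf_five {q : ℂ} (hq : ‖q‖ < 1) :
    qPochInf q q = qPochInf (q ^ 1) (q ^ 5) * qPochInf (q ^ 2) (q ^ 5) *
      qPochInf (q ^ 3) (q ^ 5) * qPochInf (q ^ 4) (q ^ 5) * qPochInf (q ^ 5) (q ^ 5) := by
  have hp := norm_pow_lt_one hq (k := 5) (by norm_num)
  have h1 := (tendsto_qPoch q hq).comp (tendsto_id.const_mul_atTop' (show 0 < 5 by norm_num))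
  have h2 := ((((tendsto_qPoch (q ^ 1) hp).mul (tendsto_qPoch (q ^ 2) hp)).mul
    (tendsto_qPoch (q ^ 3) hp)).mul (tendsto_qPoch (q ^ 4) hp)).mul (tendsto_qPoch (q ^ 5) hp)
  exact tendsto_nhds_unique h1 (h2.congr fun N => (qPoch_five_mul q N).symm)

/-- The Rogers–Ramanujan identities: for `r = 1` or `2` and `|q| < 1`,
`Σ_{n≥0} q^(n² + (r-1)n)/(q;q)_n = 1/((q^r; q^5)_∞ (q^(5-r); q^5)_∞)`. -/
theorem rogers_ramanujan (q : ℂ) (hq : ‖q‖ < 1) (r : ℕ) (hr : r = 1 ∨ r = 2) :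
    ∑' n : ℕ, q ^ (n ^ 2 + (r - 1) * n) / qPoch q q n =
      1 / (qPochInf (q ^ r) (q ^ 5) * qPochInf (q ^ (5 - r)) (q ^ 5)) := by
  have hp := norm_pow_lt_one hq (k := 5) (by norm_num)
  rcases eq_or_ne q 0 with rfl | hq0
  · rw [tsum_eq_single 0]
    · rcases hr with rfl | rfl <;> simp [qPoch, qPochInf]
    · intro n hn
      simp [hn]
  have hne : ∀ k, k ≠ 0 → qPochInf (q ^ k) (q ^ 5) ≠ 0 := fun k hk =>
    qPochInf_ne_zero (norm_pow_lt_one hq hk) hp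
  have h1 := hne 1 (by norm_num)
  have h2 := hne 2 (by norm_num)
  have h3 := hne 3 (by norm_num)
  have h4 := hne 4 (by norm_num)
  have h5 := hne 5 (by norm_num)
  simp only [div_eq_mul_inv _ (qPoch q q _)]
  change ∑' n : ℕ, q ^ (n ^ 2 + (r - 1) * n) * qPochInv q n = _
  rw [tsum_pow_mul_qPochInv hq (by omega), qPochInf_five hq]
  rcases hr with rfl | rfl
  · rw [tsum_thetaCoeff_of_finite hq 0 3 2 (sum_thetaCoeff_zero_finite hq hq0)]
    simp only [Nat.add_one_sub_one]
    field_simp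
  · rw [tsum_thetaCoeff_of_finite hq 1 4 1 (sum_thetaCoeff_one_finite hq hq0)]
    simp only [Nat.reduceSub]
    rw [pow_one] at *
    field_simp
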